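/- Let L be a 3-dimensional Lie algebra over a field F with [L,L] = L, and let L = L_α ⊕ L_β ⊕ L_γ be a Lie grading with all three components 1-dimensional. Then there exists an injective map φ of {α, β, γ} into ℤ, or into (ℤ/2ℤ)², satisfying property (P); more precisely, either (after permuting the indices) [L_α, L_β] = L_β, [L_α, L_γ] = L_γ, [L_β, L_γ] = L_α, [L_α,L_α] = [L_β,L_β] = [L_γ,L_γ] = 0, giving a ℤ-grading with α ↦ 0, β ↦ 1, γ ↦ -1, or [L_α, L_β] = L_γ, [L_β, L_γ] = L_α, [L_γ, L_α] = L_β, [L_α,L_α] = [L_β,L_β] = [L_γ,L_γ] = 0, giving a (ℤ/2ℤ)²-grading with α ↦ (1̄,1̄), β ↦ (1̄,0̄), γ ↦ (0̄,1̄). -/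

import Mathlib

/-- The span of all brackets `⁅x, y⁆` with `x ∈ A`, `y ∈ B`: the product `[A, B]`
of two subspaces of a Lie algebra. -/
def bracketSpan (F : Type*) {L : Type*} [Field F] [LieRing L] [LieAlgebra F L]
    (A B : Submodule F L) : Submodule F L :=
  Submodule.span F {z | ∃ x ∈ A, ∃ y ∈ B, z = ⁅x, y⁆}

/-- A Lie grading of the Lie algebra `L` over `F`: a family of nonzero subspaces,
whose sum is direct and equals `L`, such that for any pair of indices `g, g'` either
`[L_g, L_{g'}] = 0` or `0 ≠ [L_g, L_{g'}] ⊆ L_{g''}` for some index `g''`. -/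
def IsLieGrading (F : Type*) {L : Type*} {G : Type*} [Field F] [LieRing L] [LieAlgebra F L]
    (Lg : G → Submodule F L) : Prop :=
  (∀ g, Lg g ≠ ⊥) ∧ iSupIndep Lg ∧ (⨆ g, Lg g) = ⊤ ∧
    ∀ g g', bracketSpan F (Lg g) (Lg g') = ⊥ ∨
      ∃ g'', bracketSpan F (Lg g) (Lg g') ≠ ⊥ ∧ bracketSpan F (Lg g) (Lg g') ≤ Lg g''

/-- Property (P) for a map `φ` from the index set of a grading into a (multiplicative)
semigroup: `φ g * φ g' = φ g''` whenever `0 ≠ [L_g, L_{g'}] ⊆ L_{g''}`. -/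
def PropertyP (F : Type*) {L G S : Type*} [Field F] [LieRing L] [LieAlgebra F L] [Semigroup S]
    (Lg : G → Submodule F L) (φ : G → S) : Prop :=
  ∀ g g' g'', bracketSpan F (Lg g) (Lg g') ≠ ⊥ → bracketSpan F (Lg g) (Lg g') ≤ Lg g'' →
    φ g * φ g' = φ g''

/-- Property (P) for a map `φ` from the index set of a grading into an additive
semigroup: `φ g + φ g' = φ g''` whenever `0 ≠ [L_g, L_{g'}] ⊆ L_{g''}`. -/
def PropertyPAdd (F : Type*) {L G S : Type*} [Field F] [LieRing L] [LieAlgebra F L]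
    [AddSemigroup S] (Lg : G → Submodule F L) (φ : G → S) : Prop :=
  ∀ g g' g'', bracketSpan F (Lg g) (Lg g') ≠ ⊥ → bracketSpan F (Lg g) (Lg g') ≤ Lg g'' →
    φ g + φ g' = φ g''

section BracketSpan

variable {F L : Type*} [Field F] [LieRing L] [LieAlgebra F L]

theorem bracketSpan_eq_map₂ (A B : Submodule F L) :
    bracketSpan F A B = Submodule.map₂ (LieModule.toEnd F L L : L →ₗ[F] L →ₗ[F] L) A B := by
  rw [Submodule.map₂_eq_span_image2, bracketSpan]
  congr 1
  ext z
  simp [Set.mem_image2, eq_comm]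

theorem bracketSpan_comm (A B : Submodule F L) : bracketSpan F A B = bracketSpan F B A := by
  have key : ∀ A B : Submodule F L, bracketSpan F A B ≤ bracketSpan F B A := by
    intro A B
    refine Submodule.span_le.2 ?_
    rintro _ ⟨x, hx, y, hy, rfl⟩
    rw [← lie_skew]
    exact Submodule.neg_mem _ (Submodule.subset_span ⟨y, hy, x, hx, rfl⟩)
  exact le_antisymm (key A B) (key B A)

theorem bracketSpan_span_singleton (x y : L) :
    bracketSpan F (Submodule.span F {x}) (Submodule.span F {y}) = Submodule.span F {⁅x, y⁆} := by
  simp [bracketSpan_eq_map₂, Submodule.map₂_span_span]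

/-- The derived algebra of an algebra spanned by three elements is spanned by the three
brackets of distinct elements. -/
theorem bracketSpan_top_le_span_lie {e : Fin 3 → L}
    (he : Submodule.span F (Set.range e) = ⊤) :
    bracketSpan F (⊤ : Submodule F L) ⊤ ≤
      Submodule.span F (Set.range fun i => ⁅e (i + 1), e (i + 2)⁆) := by
  rw [← he, bracketSpan_eq_map₂, Submodule.map₂_span_span, Submodule.span_le]
  have h : ∀ i, ⁅e (i + 1), e (i + 2)⁆ ∈
      Submodule.span F (Set.range fun i => ⁅e (i + 1), e (i + 2)⁆) :=
    fun i => Submodule.subset_span ⟨i, rfl⟩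
  have hflip : ∀ i, ⁅e (i + 2), e (i + 1)⁆ ∈
      Submodule.span F (Set.range fun i => ⁅e (i + 1), e (i + 2)⁆) := fun i => by
    rw [← lie_skew]
    exact Submodule.neg_mem _ (h i)
  rintro _ ⟨_, ⟨i, rfl⟩, _, ⟨j, rfl⟩, rfl⟩
  have hij : ∀ i j : Fin 3, i = j ∨ ∃ k, (i = k + 1 ∧ j = k + 2) ∨ (i = k + 2 ∧ j = k + 1) := by
    decide
  obtain rfl | ⟨k, ⟨rfl, rfl⟩ | ⟨rfl, rfl⟩⟩ := hij i j
  · simp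
  · exact h k
  · exact hflip k

/-- If the brackets of three elements are linearly independent, they cannot be multiples of
these elements in a cyclically shifted order, by the Jacobi identity. -/
theorem not_cyclic_shift_of_linearIndependent {e : Fin 3 → L}
    (hd : LinearIndependent F fun i => ⁅e (i + 1), e (i + 2)⁆) (k : Fin 3) (hk : k ≠ 0)
    (h : ∀ i, ⁅e (i + 1), e (i + 2)⁆ ∈ Submodule.span F {e (i + k)}) : False := by
  choose c hc using fun i => Submodule.mem_span_singleton.1 (h i)
  have hd0 : ∀ i, ⁅e (i + 1), e (i + 2)⁆ ≠ 0 := hd.ne_zero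
  have hc0 : ∀ i, c i ≠ 0 := fun i hi => hd0 i (by rw [← hc i, hi, zero_smul])
  have jac := lie_jacobi (e 0) (e 1) (e 2)
  have h0 := hc 0
  have h1 := hc 1
  have h2 := hc 2
  rw [Fintype.linearIndependent_iff] at hd
  have hk' : k = 1 ∨ k = 2 := by omega
  obtain rfl | rfl := hk'
  · have := hd ![c 1, c 2, c 0] (by
      simp only [Fin.sum_univ_three, Matrix.cons_val, Fin.reduceAdd, zero_add] at *
      rw [← h0, ← h1, ← h2, lie_smul, lie_smul, lie_smul] at jac
      rw [← jac]
      abel) 0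
    exact hc0 1 this
  · have := hd ![c 2, c 0, c 1] (by
      simp only [Fin.sum_univ_three, Matrix.cons_val, Fin.reduceAdd, zero_add] at *
      rw [← h0, ← h1, ← h2, lie_smul, lie_smul, lie_smul, ← lie_skew (e 0) (e 2),
        ← lie_skew (e 1) (e 0), ← lie_skew (e 2) (e 1)] at jac
      rw [← neg_eq_zero, ← jac]
      simp only [smul_neg]
      abel) 0
    exact hc0 2 this

/-- Property (P) for a family of three independent nonzero subspaces, read off from the table
of products of distinct components. -/
theorem propertyPAdd_of_bracketSpan_eq {S : Type*} [AddCommSemigroup S]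
    {N : Fin 3 → Submodule F L} (hne : ∀ i, N i ≠ ⊥) (hind : iSupIndep N)
    (hself : ∀ i, bracketSpan F (N i) (N i) = ⊥) (s : Fin 3 → Fin 3)
    (hs : ∀ i, bracketSpan F (N (i + 1)) (N (i + 2)) = N (s i))
    (φ : Fin 3 → S) (hφ : ∀ i, φ (i + 1) + φ (i + 2) = φ (s i)) :
    PropertyPAdd F N φ := by
  have hle : ∀ i j, N i ≤ N j → i = j := by
    intro i j hij
    by_contra hne'
    exact hne i ((hind.pairwiseDisjoint hne').eq_bot_of_le hij)
  intro i j l hb hl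
  have hij : ∀ i j : Fin 3, i = j ∨ ∃ k, (i = k + 1 ∧ j = k + 2) ∨ (i = k + 2 ∧ j = k + 1) := by
    decide
  obtain rfl | ⟨k, ⟨rfl, rfl⟩ | ⟨rfl, rfl⟩⟩ := hij i j
  · exact absurd (hself i) hb
  · rw [hs] at hl
    rw [hφ, hle _ _ hl]
  · rw [bracketSpan_comm, hs] at hl
    rw [add_comm, hφ, hle _ _ hl]

theorem PropertyPAdd.comp_symm {G S : Type*} [AddSemigroup S] {M : G → Submodule F L}
    {σ : Equiv.Perm G} {φ : G → S} (h : PropertyPAdd F (fun i => M (σ i)) φ) :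
    PropertyPAdd F M (φ ∘ σ.symm) := fun i j l hb hl =>
  h (σ.symm i) (σ.symm j) (σ.symm l) (by simpa using hb) (by simpa using hl)

/-- In a perfect three-dimensional Lie algebra with a Lie grading by three lines, the products
of distinct components are given either by the cyclic pattern or by a reflected one. -/
theorem exists_bracketSpan_pattern [FiniteDimensional F L] (hdim : Module.finrank F L = 3)
    (hperf : bracketSpan F (⊤ : Submodule F L) ⊤ = ⊤) {M : Fin 3 → Submodule F L}
    (hgrad : IsLieGrading F M) (hM : ∀ i, Module.finrank F (M i) = 1) :
    (∀ i, bracketSpan F (M i) (M i) = ⊥) ∧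
      ((∀ i, bracketSpan F (M (i + 1)) (M (i + 2)) = M i) ∨
        ∃ k, ∀ i, bracketSpan F (M (k + (i + 1))) (M (k + (i + 2))) = M (k + -i)) := by
  obtain ⟨-, -, htop, hbr⟩ := hgrad
  have hex : ∀ i, ∃ v, M i = Submodule.span F {v} := fun i => by
    obtain ⟨v, -, hv⟩ := finrank_eq_one_iff'.1 (hM i)
    refine ⟨v, le_antisymm (fun w hw => ?_) ?_⟩
    · obtain ⟨c, hc⟩ := hv ⟨w, hw⟩
      exact Submodule.mem_span_singleton.2 ⟨c, congrArg Subtype.val hc⟩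
    · simp
  choose e he using hex
  have hspan : Submodule.span F (Set.range e) = ⊤ := by
    rw [← htop, Submodule.span_range_eq_iSup]
    simp [he]
  have hd : LinearIndependent F fun i => ⁅e (i + 1), e (i + 2)⁆ :=
    linearIndependent_of_top_le_span_of_card_eq_finrank
      (hperf ▸ bracketSpan_top_le_span_lie hspan) (by simp [hdim])
  have hB : ∀ i j, bracketSpan F (M i) (M j) = Submodule.span F {⁅e i, e j⁆} := fun i j => by
    rw [he i, he j, bracketSpan_span_singleton]
  refine ⟨fun i => by simp [hB], ?_⟩
  have ht : ∀ i, ∃ t, bracketSpan F (M (i + 1)) (M (i + 2)) = M t := fun i => by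
    have hi : bracketSpan F (M (i + 1)) (M (i + 2)) ≠ ⊥ := by
      rw [hB, Ne, Submodule.span_singleton_eq_bot]
      exact hd.ne_zero i
    obtain h | ⟨t, -, h⟩ := hbr (i + 1) (i + 2)
    · exact absurd h hi
    · refine ⟨t, Submodule.eq_of_le_of_finrank_eq h ?_⟩
      rw [hM, hB, finrank_span_singleton (hd.ne_zero i)]
  choose t ht using ht
  have hinj : Function.Injective t := fun i j hij => by
    by_contra hne
    have hdis := hd.iSupIndep_span_singleton.pairwiseDisjoint hne
    have heq : Submodule.span F {⁅e (i + 1), e (i + 2)⁆} =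
        Submodule.span F {⁅e (j + 1), e (j + 2)⁆} := by
      rw [← hB, ← hB, ht, ht, hij]
    have hbot := hdis.eq_bot_of_le heq.le
    exact hd.ne_zero i (Submodule.span_singleton_eq_bot.1 hbot)
  have hclass : ∀ t : Fin 3 → Fin 3, Function.Injective t →
      (∀ i, t i = i) ∨ (∃ k, k ≠ 0 ∧ ∀ i, t i = i + k) ∨ ∃ k, ∀ i, t (k + i) = k + -i := by
    decide
  obtain h | ⟨k, hk, h⟩ | ⟨k, h⟩ := hclass t hinj
  · exact Or.inl fun i => by rw [ht, h]
  · refine (not_cyclic_shift_of_linearIndependent hd k hk fun i => ?_).elim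
    rw [← he, ← h, ← ht, hB]
    exact Submodule.mem_span_singleton_self _
  · exact Or.inr ⟨k, fun i => by rw [← add_assoc, ← add_assoc, ht, h]⟩

end BracketSpan

/-- A three-dimensional Lie algebra with `[L,L] = L`, graded with three one-dimensional
components: then there is an injective map of the index set into `ℤ`, or into `(ℤ/2ℤ)²`,
satisfying property (P); more precisely, after permuting the indices either the brackets
display the `ℤ`-grading pattern (with `α ↦ 0`, `β ↦ 1`, `γ ↦ -1`) or the cyclic
`(ℤ/2ℤ)²`-grading pattern (with `α ↦ (1̄,1̄)`, `β ↦ (1̄,0̄)`, `γ ↦ (0̄,1̄)`). -/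
theorem three_dim_perfect_case_b
    {F L : Type*} [Field F] [LieRing L] [LieAlgebra F L] [FiniteDimensional F L]
    (hdim : Module.finrank F L = 3)
    (hperf : bracketSpan F (⊤ : Submodule F L) ⊤ = ⊤)
    (Lα Lβ Lγ : Submodule F L)
    (hgrad : IsLieGrading F ![Lα, Lβ, Lγ])
    (hdimα : Module.finrank F Lα = 1) (hdimβ : Module.finrank F Lβ = 1)
    (hdimγ : Module.finrank F Lγ = 1) :
    ((∃ φ : Fin 3 → ℤ, Function.Injective φ ∧ PropertyPAdd F ![Lα, Lβ, Lγ] φ) ∨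
      (∃ φ : Fin 3 → ZMod 2 × ZMod 2, Function.Injective φ ∧
        PropertyPAdd F ![Lα, Lβ, Lγ] φ)) ∧
    ∃ σ : Equiv.Perm (Fin 3),
      ((bracketSpan F (![Lα, Lβ, Lγ] (σ 0)) (![Lα, Lβ, Lγ] (σ 1)) = ![Lα, Lβ, Lγ] (σ 1) ∧
        bracketSpan F (![Lα, Lβ, Lγ] (σ 0)) (![Lα, Lβ, Lγ] (σ 2)) = ![Lα, Lβ, Lγ] (σ 2) ∧
        bracketSpan F (![Lα, Lβ, Lγ] (σ 1)) (![Lα, Lβ, Lγ] (σ 2)) = ![Lα, Lβ, Lγ] (σ 0) ∧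
        bracketSpan F (![Lα, Lβ, Lγ] (σ 0)) (![Lα, Lβ, Lγ] (σ 0)) = ⊥ ∧
        bracketSpan F (![Lα, Lβ, Lγ] (σ 1)) (![Lα, Lβ, Lγ] (σ 1)) = ⊥ ∧
        bracketSpan F (![Lα, Lβ, Lγ] (σ 2)) (![Lα, Lβ, Lγ] (σ 2)) = ⊥ ∧
        Function.Injective (![0, 1, -1] : Fin 3 → ℤ) ∧
        PropertyPAdd F (fun i => ![Lα, Lβ, Lγ] (σ i)) (![0, 1, -1] : Fin 3 → ℤ)) ∨
      (bracketSpan F (![Lα, Lβ, Lγ] (σ 0)) (![Lα, Lβ, Lγ] (σ 1)) = ![Lα, Lβ, Lγ] (σ 2) ∧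
        bracketSpan F (![Lα, Lβ, Lγ] (σ 1)) (![Lα, Lβ, Lγ] (σ 2)) = ![Lα, Lβ, Lγ] (σ 0) ∧
        bracketSpan F (![Lα, Lβ, Lγ] (σ 2)) (![Lα, Lβ, Lγ] (σ 0)) = ![Lα, Lβ, Lγ] (σ 1) ∧
        bracketSpan F (![Lα, Lβ, Lγ] (σ 0)) (![Lα, Lβ, Lγ] (σ 0)) = ⊥ ∧
        bracketSpan F (![Lα, Lβ, Lγ] (σ 1)) (![Lα, Lβ, Lγ] (σ 1)) = ⊥ ∧
        bracketSpan F (![Lα, Lβ, Lγ] (σ 2)) (![Lα, Lβ, Lγ] (σ 2)) = ⊥ ∧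
        Function.Injective (![(1, 1), (1, 0), (0, 1)] : Fin 3 → ZMod 2 × ZMod 2) ∧
        PropertyPAdd F (fun i => ![Lα, Lβ, Lγ] (σ i))
          (![(1, 1), (1, 0), (0, 1)] : Fin 3 → ZMod 2 × ZMod 2))) := by
  set M : Fin 3 → Submodule F L := ![Lα, Lβ, Lγ] with hMdef
  have hM : ∀ i, Module.finrank F (M i) = 1 := by
    intro i
    fin_cases i
    exacts [hdimα, hdimβ, hdimγ]
  have hinjZ : Function.Injective (![0, 1, -1] : Fin 3 → ℤ) := by decide
  have hinjV : Function.Injective (![(1, 1), (1, 0), (0, 1)] : Fin 3 → ZMod 2 × ZMod 2) := by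
    decide
  obtain ⟨hself, h | ⟨k, h⟩⟩ := exists_bracketSpan_pattern hdim hperf hgrad hM
  · have hP : PropertyPAdd F (fun i => M ((1 : Equiv.Perm (Fin 3)) i))
        (![(1, 1), (1, 0), (0, 1)] : Fin 3 → ZMod 2 × ZMod 2) :=
      propertyPAdd_of_bracketSpan_eq hgrad.1 hgrad.2.1 hself id h _ (by decide)
    exact ⟨Or.inr ⟨_, hinjV.comp (Equiv.injective _), hP.comp_symm⟩, 1,
      Or.inr ⟨h 2, h 0, h 1, hself _, hself _, hself _, hinjV, hP⟩⟩
  · have hP : PropertyPAdd F (fun i => M (Equiv.addLeft k i)) (![0, 1, -1] : Fin 3 → ℤ) :=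
      propertyPAdd_of_bracketSpan_eq (fun i => hgrad.1 _)
        (hgrad.2.1.comp (Equiv.addLeft k).injective) (fun i => hself _) (fun i => -i) h _
        (by decide)
    exact ⟨Or.inl ⟨_, hinjZ.comp (Equiv.injective _), hP.comp_symm⟩, Equiv.addLeft k,
      Or.inl ⟨h 2, (bracketSpan_comm _ _).trans (h 1), h 0, hself _, hself _, hself _,
        hinjZ, hP⟩⟩
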